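/- arXiv:1202.4041 — 13 statements merged into one kernel-verified Lean document; each statement's English description precedes it below -/
import Mathlib

section
/- Let P > 0. For every real a with 1/P < a ≤ (−1+√(1+4P))/(2P), one has log2(1 + aP + 1/a) − 1 ≤ log2(1 + P/(1+aP)). -/
open Real

theorem stmt_3 (P : ℝ) (hP : 0 < P) (a : ℝ) (h1 : 1/P < a)
    (h2 : a ≤ (-1 + Real.sqrt (1 + 4*P)) / (2*P)) :
    logb 2 (1 + a*P + 1/a) - 1 ≤ logb 2 (1 + P / (1 + a*P)) := by
  have ha : 0 < a := lt_trans (by positivity) h1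
  have hx : 1 < a * P := (div_lt_iff₀ hP).1 h1
  have hs : 0 < 1 + a * P := by positivity
  have hq : a * (1 + a * P) ≤ 1 := by
    rw [le_div_iff₀ (by positivity)] at h2
    have hsq : (2 * (a * P) + 1) ^ 2 ≤ 1 + 4 * P :=
      (Real.le_sqrt (by positivity) (by positivity)).1 (by linarith)
    refine le_of_mul_le_mul_left ?_ hP
    nlinarith
  have key : 1 + a * P + 1 / a ≤ 2 * (1 + P / (1 + a * P)) := by
    have hdiff : 2 * (1 + P / (1 + a * P)) - (1 + a * P + 1 / a)
        = (a * P - 1) * (1 - a * (1 + a * P)) / (a * (1 + a * P)) := by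
      field_simp
      ring
    have hnonneg : 0 ≤ (a * P - 1) * (1 - a * (1 + a * P)) / (a * (1 + a * P)) :=
      div_nonneg (mul_nonneg (by linarith) (by linarith)) (by positivity)
    linarith
  have hlog := Real.logb_le_logb_of_le (b := 2) (by norm_num) (by positivity) key
  rw [Real.logb_mul (by norm_num) (by positivity),
    Real.logb_self_eq_one (by norm_num)] at hlog
  linarith
end

section
/- Let P > (27+7√21)/18 be a real number. Then for every real a > 0, 2·P²·a³ − 3·P·a² − 2·a + 1 > 0. -/
/-- The factorization of `2x³ - 3x² - 2x` minus its local minimum, attained at `(3 + √21) / 6`. -/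
theorem cubic_eq_sq_mul_sub (x : ℝ) :
    2 * x ^ 3 - 3 * x ^ 2 - 2 * x =
      (x - (3 + √21) / 6) ^ 2 * (2 * x + (2 * √21 - 3) / 3) - (27 + 7 * √21) / 18 := by
  have h : √21 ^ 2 = (21 : ℝ) := Real.sq_sqrt (by norm_num)
  have h3 : √21 ^ 3 = 21 * √21 := by rw [pow_succ, h]
  ring_nf
  rw [h3, h]
  ring

theorem stmt_7 (P : ℝ) (hP : P > (27 + 7 * Real.sqrt 21) / 18) :
    ∀ a : ℝ, 0 < a → 2 * P^2 * a^3 - 3 * P * a^2 - 2 * a + 1 > 0 := by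
  intro a ha
  have hs : 3 / 2 < √21 := Real.lt_sqrt_of_sq_lt (by norm_num)
  have hP0 : 0 < P := lt_trans (by positivity) hP
  have hx : 0 < P * a := mul_pos hP0 ha
  have hnonneg : 0 ≤ (P * a - (3 + √21) / 6) ^ 2 * (2 * (P * a) + (2 * √21 - 3) / 3) :=
    mul_nonneg (sq_nonneg _) (by linarith)
  refine pos_of_mul_pos_right (a := P) ?_ hP0.le
  linarith [cubic_eq_sq_mul_sub (P * a)]
end

section
/- For P ≥ 4, define a₁(P) = (5P + 2 − √(17P² + 12P + 4))/(4P) and F(P) = P·a₁(P)³ + a₁(P)² − a₁(P) − 1. Then F is strictly increasing on [4, ∞), and F(100) < 0. Consequently, for every real P with 4 ≤ P ≤ 100, one has P·a₁(P)³ + a₁(P)² − a₁(P) − 1 < 0. -/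
noncomputable def a₁ (P : ℝ) : ℝ := (5*P + 2 - Real.sqrt (17*P^2 + 12*P + 4)) / (4*P)

noncomputable def F (P : ℝ) : ℝ := P * (a₁ P)^3 + (a₁ P)^2 - a₁ P - 1

theorem a₁_quadratic {P : ℝ} (hP : 0 < P) :
    P * (5 * a₁ P - 1 - 2 * (a₁ P)^2) = 1 - 2 * a₁ P := by
  have hs := Real.sq_sqrt (show 0 ≤ 17*P^2 + 12*P + 4 by positivity)
  unfold a₁
  generalize Real.sqrt (17*P^2 + 12*P + 4) = s at *
  field_simp
  linear_combination (-2) * hs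

theorem one_fifth_lt_a₁ {P : ℝ} (hP : 0 < P) : 1/5 < a₁ P := by
  have hs : Real.sqrt (17*P^2 + 12*P + 4) < 21/5*P + 2 := by
    rw [Real.sqrt_lt' (by positivity)]
    nlinarith
  unfold a₁
  rw [lt_div_iff₀ (by positivity)]
  linarith

theorem a₁_le_one_fourth {P : ℝ} (hP : 4 ≤ P) : a₁ P ≤ 1/4 := by
  have hs : 4*P + 2 ≤ Real.sqrt (17*P^2 + 12*P + 4) := by
    apply Real.le_sqrt_of_sq_le
    nlinarith
  unfold a₁
  rw [div_le_iff₀ (by positivity)]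
  linarith

theorem a₁_strictAntiOn : StrictAntiOn a₁ (Set.Ici (4 : ℝ)) := by
  intro P (hP : 4 ≤ P) Q (hQ : 4 ≤ Q) hPQ
  have eP := a₁_quadratic (show 0 < P by linarith)
  have eQ := a₁_quadratic (show 0 < Q by linarith)
  have uP := a₁_le_one_fourth hP
  have uQ := a₁_le_one_fourth hQ
  by_contra! h
  have hg : 0 < 5 * a₁ P - 1 - 2 * (a₁ P)^2 := by
    refine pos_of_mul_pos_right (a := P) ?_ (by linarith)
    linarith
  have hmono : 5 * a₁ P - 1 - 2 * (a₁ P)^2 ≤ 5 * a₁ Q - 1 - 2 * (a₁ Q)^2 := by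
    nlinarith
  nlinarith [mul_lt_mul_of_pos_right hPQ hg,
    mul_le_mul_of_nonneg_left hmono (show 0 ≤ Q by linarith)]

/-- The map `a ↦ a³ (1 - 2a) / (5a - 1 - 2a²)` is decreasing on `[1/5, 1/4]`, with
denominators cleared. -/
theorem cube_mul_cross_lt {a b : ℝ} (hb : 1/5 < b) (hba : b < a) (ha : a ≤ 1/4) :
    a^3 * (1 - 2*a) * (5*b - 1 - 2*b^2) < b^3 * (1 - 2*b) * (5*a - 1 - 2*a^2) := by
  have hg : 5*b - 1 - 2*b^2 ≤ 1/8 := by nlinarith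
  have hs : a^2 + a*b + b^2 - 2*(a + b)*(a^2 + b^2) ≤ 124/1000 := by
    have h1 : a^2 + a*b + b^2 ≤ 3/16 := by nlinarith
    have h2 : (2/5) * (2/25) ≤ (a + b) * (a^2 + b^2) := by
      apply mul_le_mul <;> nlinarith
    linarith
  have hs0 : 0 ≤ a^2 + a*b + b^2 - 2*(a + b)*(a^2 + b^2) := by
    have : 0 ≤ (a^2 + b^2) * (1 - 2*(a + b)) := by
      apply mul_nonneg <;> nlinarith
    nlinarith [mul_pos (show 0 < a by linarith) (show 0 < b by linarith)]
  have hc : 1/125 ≤ b^3 := by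
    have := pow_le_pow_left₀ (by norm_num) hb.le 3
    linarith
  have hd : 2 ≤ (1 - 2*b) * (5 - 2*(a + b)) := by nlinarith
  have hlo : 1/125 * 2 ≤ b^3 * ((1 - 2*b) * (5 - 2*(a + b))) := by
    apply mul_le_mul hc hd <;> positivity
  have hhi : (a^2 + a*b + b^2 - 2*(a + b)*(a^2 + b^2)) * (5*b - 1 - 2*b^2)
      ≤ 124/1000 * (1/8) := by
    nlinarith
  have hK : 0 < b^3 * ((1 - 2*b) * (5 - 2*(a + b)))
      - (a^2 + a*b + b^2 - 2*(a + b)*(a^2 + b^2)) * (5*b - 1 - 2*b^2) := by linarith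
  have := mul_pos (sub_pos.2 hba) hK
  linarith

theorem F_strictMonoOn : StrictMonoOn F (Set.Ici (4 : ℝ)) := by
  intro P (hP : 4 ≤ P) Q (hQ : 4 ≤ Q) hPQ
  have eP := a₁_quadratic (show 0 < P by linarith)
  have eQ := a₁_quadratic (show 0 < Q by linarith)
  have uP := a₁_le_one_fourth hP
  have uQ := a₁_le_one_fourth hQ
  have hanti := a₁_strictAntiOn hP hQ hPQ
  have hcross := cube_mul_cross_lt (one_fifth_lt_a₁ (show 0 < Q by linarith)) hanti uP
  unfold F
  generalize a₁ P = a at *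
  generalize a₁ Q = b at *
  have ga : 0 < 5*a - 1 - 2*a^2 :=
    pos_of_mul_pos_right (a := P) (by linarith) (by linarith)
  have gb : 0 < 5*b - 1 - 2*b^2 :=
    pos_of_mul_pos_right (a := Q) (by linarith) (by linarith)
  have hcube : P * a^3 < Q * b^3 := by
    rw [← eP, ← eQ] at hcross
    refine lt_of_mul_lt_mul_right ?_ (mul_pos ga gb).le
    linarith
  nlinarith

theorem F_hundred_neg : F 100 < 0 := by
  have hs : (413 : ℝ) ≤ Real.sqrt (17*100^2 + 12*100 + 4) := by
    apply Real.le_sqrt_of_sq_le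
    norm_num
  have hu : a₁ 100 ≤ 89/400 := by
    unfold a₁
    rw [div_le_iff₀ (by positivity)]
    generalize Real.sqrt (17*100^2 + 12*100 + 4) = s at *
    linarith
  have hl := one_fifth_lt_a₁ (show (0 : ℝ) < 100 by norm_num)
  have hcube := pow_le_pow_left₀ (by linarith) hu 3
  unfold F
  nlinarith

theorem stmt_8 :
    StrictMonoOn F (Set.Ici (4 : ℝ)) ∧ F 100 < 0 ∧
      ∀ P : ℝ, 4 ≤ P → P ≤ 100 → P * (a₁ P)^3 + (a₁ P)^2 - a₁ P - 1 < 0 := by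
  refine ⟨F_strictMonoOn, F_hundred_neg, fun P hP hP' => ?_⟩
  exact (F_strictMonoOn.monotoneOn hP (show (4 : ℝ) ≤ 100 by norm_num) hP').trans_lt
    F_hundred_neg
end

section
/- Let P and a be real numbers with 0 < P ≤ 100 and (−1+√(1+4P))/(2P) < a ≤ 1. Define C_ETW(P,a) = log2(1 + P/(1+aP)) if a ≤ 1/P, and C_ETW(P,a) = min{ (1/2)·log2(1+P+aP) + (1/2)·log2(2+1/a) − 1, log2(1+aP+1/a) − 1 } if a > 1/P. Then (1/2)·log2(1+2P) > C_ETW(P,a). -/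
open Real

/-- Above the positive root of `P * x ^ 2 + x - 1`, the quadratic is positive. -/
lemma one_lt_quadratic_of_root_lt {P a : ℝ} (hP : 0 < P)
    (h : (-1 + Real.sqrt (1 + 4*P)) / (2*P) < a) : 0 < a ∧ 1 < P * a ^ 2 + a := by
  rw [div_lt_iff₀ (by positivity)] at h
  have h1 : 1 < Real.sqrt (1 + 4*P) := by
    rw [Real.lt_sqrt (by norm_num)]
    linarith
  have h2 : Real.sqrt (1 + 4*P) < 1 + 2 * P * a := by linarith
  have ha : 0 < a := by
    by_contra! hn
    nlinarith
  refine ⟨ha, ?_⟩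
  rw [Real.sqrt_lt' (by positivity)] at h2
  have h3 : 0 < 4 * P * (P * a ^ 2 + a - 1) := by nlinarith
  have h4 := pos_of_mul_pos_right h3 (by positivity)
  linarith

lemma quadratic_neg_or_sq_lt {P a : ℝ} (hP' : P ≤ 100) (ha : 0 < a) (ha2 : a ≤ 1)
    (h : 1 < P * a ^ 2 + a) :
    (1 + P + a*P) * (2*a + 1) < 4 * a * (1 + 2*P) ∨
      (a + a^2 * P + 1)^2 < 4 * a^2 * (1 + 2*P) := by
  rcases le_or_gt a (23/100) with hs | hs
  · right
    have hv : P * a ^ 2 + a ≤ 552/100 := by nlinarith [sq_nonneg a]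
    have h1 : (P * a ^ 2 + a - 1) * (P * a ^ 2 + a - 5) < 4 * (1 - a) ^ 2 := by
      have h2 : (P * a ^ 2 + a - 1) * (P * a ^ 2 + a - 5) ≤ 236/100 := by nlinarith
      nlinarith
    nlinarith
  · left
    by_contra! hn
    have h1 : 0 < 5 * a - 1 - 2 * a ^ 2 := by nlinarith
    have h2 : 0 < (P * a ^ 2 + a - 1) * (5 * a - 1 - 2 * a ^ 2) :=
      mul_pos (by linarith) h1
    have h3 : 0 < 4 * a ^ 3 - 8 * a ^ 2 + 6 * a - 1 := by
      nlinarith [mul_pos (sub_pos.2 hs) (sq_nonneg (a - 1/2) |>.trans_lt (lt_add_one _)),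
        mul_nonneg (sub_pos.2 hs).le (sq_nonneg (a - 885/1000))]
    have h4 : P * (5 * a - 1 - 2 * a ^ 2) ≤ 1 - 2 * a := by linarith
    nlinarith [mul_le_mul_of_nonneg_left h4 (sq_nonneg a)]

lemma half_logb_add_half_logb_sub_one_lt {x y z : ℝ} (hx : 0 < x) (hy : 0 < y)
    (h : x * y < 4 * z) :
    (1/2) * logb 2 x + (1/2) * logb 2 y - 1 < (1/2) * logb 2 z := by
  have hz : 0 < z := by nlinarith [mul_pos hx hy]
  have h4 : logb 2 (4 : ℝ) = 2 := by
    rw [show (4 : ℝ) = 2 ^ (2 : ℕ) by norm_num, Real.logb_pow]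
    simp
  have hl := Real.logb_lt_logb (b := 2) (by norm_num) (mul_pos hx hy) h
  rw [Real.logb_mul hx.ne' hy.ne', Real.logb_mul (by norm_num) hz.ne', h4] at hl
  linarith

theorem stmt_9 (P a : ℝ) (hP : 0 < P) (hP' : P ≤ 100)
    (ha1 : (-1 + Real.sqrt (1 + 4*P)) / (2*P) < a) (ha2 : a ≤ 1) :
    (1/2) * logb 2 (1 + 2*P) >
      (if a ≤ 1/P then logb 2 (1 + P / (1 + a*P))
       else min ((1/2) * logb 2 (1 + P + a*P) + (1/2) * logb 2 (2 + 1/a) - 1)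
                (logb 2 (1 + a*P + 1/a) - 1)) := by
  obtain ⟨ha, h⟩ := one_lt_quadratic_of_root_lt hP ha1
  split_ifs
  · have hsq : (1 + P / (1 + a*P)) ^ 2 < 1 + 2*P := by
      have hd : 0 < 1 + a*P := by positivity
      rw [one_add_div hd.ne', div_pow, div_lt_iff₀ (by positivity)]
      have h1 : 0 < P ^ 2 * (2 * (P * a ^ 2 + a) - 1) := mul_pos (by positivity) (by linarith)
      nlinarith
    have hl := Real.logb_lt_logb (b := 2) (by norm_num) (by positivity) hsq
    rw [Real.logb_pow] at hl
    push_cast at hl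
    linarith
  · rw [gt_iff_lt, min_lt_iff]
    rcases quadratic_neg_or_sq_lt hP' ha ha2 h with hq | hq
    · left
      refine half_logb_add_half_logb_sub_one_lt (by positivity) (by positivity) ?_
      rw [show (1 + P + a*P) * (2 + 1/a) = (1 + P + a*P) * (2*a + 1) / a by field_simp,
        div_lt_iff₀ ha]
      linarith
    · right
      have hp : 0 < 1 + a*P + 1/a := by positivity
      have hl := half_logb_add_half_logb_sub_one_lt (z := 1 + 2*P) hp hp (by
        rw [show (1 + a*P + 1/a) * (1 + a*P + 1/a) = (a + a^2 * P + 1)^2 / a^2 by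
          field_simp, div_lt_iff₀ (by positivity)]
        linarith)
      linarith
end

section
/- Let P > 100 be a real number. Then for every real a > 0, 2·P²·a³ − 9·P·a² − 6·a + 3 > 0. -/
theorem stmt_10 (P : ℝ) (hP : P > 100) :
    ∀ a : ℝ, 0 < a → 2 * P^2 * a^3 - 9 * P * a^2 - 6 * a + 3 > 0 := by
  intro a ha
  have hP0 : 0 < P := by linarith
  have key : P * (2 * P^2 * a^3 - 9 * P * a^2 - 6 * a + 3)
      = 2 * (P * a) * (P * a - 3)^2 + 3 * (P * a - 4)^2 + 3 * (P - 16) := by ring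
  have h₁ : 0 ≤ 2 * (P * a) * (P * a - 3)^2 := by positivity
  have h₂ : 0 ≤ 3 * (P * a - 4)^2 := by positivity
  exact pos_of_mul_pos_right (by linarith) hP0.le
end

section
/- For P > 100, define a₂(P) = (13P + 6 − √(161P² + 148P + 36))/(4P) and G(P) = P·a₂(P)³ + a₂(P)² − a₂(P) − 1. Then G is strictly increasing on (100, ∞), and G(1000) < 0. Consequently, for every real P with 100 < P ≤ 1000, one has P·a₂(P)³ + a₂(P)² − a₂(P) − 1 < 0. -/
noncomputable def a₂ (P : ℝ) : ℝ := (13*P + 6 - Real.sqrt (161*P^2 + 148*P + 36)) / (4*P)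

noncomputable def G (P : ℝ) : ℝ := P * (a₂ P)^3 + (a₂ P)^2 - a₂ P - 1

theorem a₂_quadratic {P : ℝ} (hP : 0 < P) :
    2 * P * a₂ P ^ 2 - (13 * P + 6) * a₂ P + 1 + P = 0 := by
  have hs := Real.sq_sqrt (show (0 : ℝ) ≤ 161 * P ^ 2 + 148 * P + 36 by positivity)
  unfold a₂
  set s := Real.sqrt (161 * P ^ 2 + 148 * P + 36)
  field_simp
  linear_combination 2 * hs

theorem a₂_lt {P : ℝ} (hP : 100 < P) : a₂ P < 0.08 := by
  have h : 12.68 * P + 6 < Real.sqrt (161 * P ^ 2 + 148 * P + 36) := by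
    apply Real.lt_sqrt_of_sq_lt
    nlinarith
  unfold a₂
  rw [div_lt_iff₀ (by linarith)]
  linarith

theorem lt_a₂ {P : ℝ} (hP : 100 < P) : 0.077 < a₂ P := by
  have h : Real.sqrt (161 * P ^ 2 + 148 * P + 36) < 12.692 * P + 6 := by
    rw [Real.sqrt_lt' (by linarith)]
    nlinarith
  unfold a₂
  rw [lt_div_iff₀ (by linarith)]
  linarith

theorem G_strictMonoOn : StrictMonoOn G (Set.Ioi (100 : ℝ)) := by
  intro x hx y hy hxy
  rw [Set.mem_Ioi] at hx hy
  have qx := a₂_quadratic (show 0 < x by linarith)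
  have qy := a₂_quadratic (show 0 < y by linarith)
  have ux := a₂_lt hx
  have uy := a₂_lt hy
  have lx := lt_a₂ hx
  have ly := lt_a₂ hy
  unfold G
  generalize a₂ x = a at *
  generalize a₂ y = b at *
  have hc : y * (13 * b - 1 - 2 * b ^ 2) = 1 - 6 * b := by linear_combination -qy
  have hc0 : 0 < 13 * b - 1 - 2 * b ^ 2 := by
    refine pos_of_mul_pos_right (a := y) ?_ (by linarith)
    rw [hc]; linarith
  have hc1 : 13 * b - 1 - 2 * b ^ 2 < 0.006 := by
    by_contra! h
    nlinarith
  have hd : (a - b) * (13 * x + 6 - 2 * x * (a + b)) = (y - x) * (13 * b - 1 - 2 * b ^ 2) := by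
    linear_combination qy - qx
  have hk : 12 * x < 13 * x + 6 - 2 * x * (a + b) := by nlinarith
  have hab : 0 < a - b := by
    refine pos_of_mul_pos_left (b := 13 * x + 6 - 2 * x * (a + b)) ?_ (by linarith)
    rw [hd]
    exact mul_pos (by linarith) hc0
  have hxab : x * (a - b) < 0.0005 * (y - x) := by
    have h1 := mul_lt_mul_of_pos_left hk hab
    have h2 := mul_lt_mul_of_pos_left hc1 (sub_pos.2 hxy)
    linarith
  have hq : a ^ 2 + a * b + b ^ 2 < 0.02 := by nlinarith
  have hcube : x * (a - b) * (a ^ 2 + a * b + b ^ 2) < 0.0005 * (y - x) * 0.02 :=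
    mul_lt_mul'' hxab hq (mul_nonneg (by linarith) hab.le) (by positivity)
  have hb3 : (0.077 : ℝ) ^ 3 < b ^ 3 := by gcongr
  have h3 := mul_lt_mul_of_pos_left hb3 (sub_pos.2 hxy)
  have h4 : 0 < (a - b) * (1 - a - b) := mul_pos hab (by linarith)
  have h5 : (y * b ^ 3 + b ^ 2 - b - 1) - (x * a ^ 3 + a ^ 2 - a - 1)
      = (y - x) * b ^ 3 - x * (a - b) * (a ^ 2 + a * b + b ^ 2) + (a - b) * (1 - a - b) := by
    ring
  linarith

theorem G_thousand_neg : G 1000 < 0 := by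
  have u := a₂_lt (show (100 : ℝ) < 1000 by norm_num)
  have l := lt_a₂ (show (100 : ℝ) < 1000 by norm_num)
  have h3 : a₂ 1000 ^ 3 < 0.08 ^ 3 := by gcongr
  unfold G
  nlinarith

theorem stmt_11 :
    StrictMonoOn G (Set.Ioi (100 : ℝ)) ∧ G 1000 < 0 ∧
      ∀ P : ℝ, 100 < P → P ≤ 1000 → P * (a₂ P)^3 + (a₂ P)^2 - a₂ P - 1 < 0 := by
  refine ⟨G_strictMonoOn, G_thousand_neg, fun P hP hP' => ?_⟩
  have h : G P ≤ G 1000 :=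
    G_strictMonoOn.monotoneOn hP (show (100 : ℝ) < 1000 by norm_num) hP'
  exact h.trans_lt G_thousand_neg
end

section
/- Let P and a be real numbers with 0 < P ≤ 1000 and (−1+√(1+4P))/(2P) < a ≤ 1. Define C_ETW(P,a) = log2(1 + P/(1+aP)) if a ≤ 1/P, and C_ETW(P,a) = min{ (1/2)·log2(1+P+aP) + (1/2)·log2(2+1/a) − 1, log2(1+aP+1/a) − 1 } if a > 1/P. Then (1/2)·log2(1+2P) > C_ETW(P,a) − 1/2. -/
open Real

/-- Lower bound on `a` given by the positive root of `P * a ^ 2 + a = 1`. -/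
lemma one_lt_add_sq_mul_of_root_lt {P a : ℝ} (hP : 0 < P)
    (h : (-1 + Real.sqrt (1 + 4*P)) / (2*P) < a) : 0 < a ∧ 1 < a + a ^ 2 * P := by
  have hs : Real.sqrt (1 + 4*P) ^ 2 = 1 + 4*P := Real.sq_sqrt (by linarith)
  have hs1 : 1 < Real.sqrt (1 + 4*P) := by
    rw [Real.lt_sqrt (by norm_num)]
    linarith
  rw [div_lt_iff₀ (by linarith)] at h
  have ha : 0 < a := pos_of_mul_pos_left (by linarith : 0 < a * (2*P)) (by linarith)
  refine ⟨ha, ?_⟩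
  have hsq : 1 + 4*P < (a * (2*P) + 1) ^ 2 := by
    rw [← hs]
    exact pow_lt_pow_left₀ (by linarith) (by linarith) two_ne_zero
  have : P * 1 < P * (a + a ^ 2 * P) := by nlinarith
  exact lt_of_mul_lt_mul_left this hP.le

lemma logb_two_four : logb 2 4 = 2 := by
  rw [show (4 : ℝ) = 2 ^ 2 by norm_num, logb_pow, logb_self_eq_one (by norm_num)]
  norm_num

lemma logb_two_two_mul {x : ℝ} (hx : 0 < x) : logb 2 (2 * x) = 1 + logb 2 x := by
  rw [logb_mul (by norm_num) hx.ne', logb_self_eq_one (by norm_num)]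

theorem stmt_12 (P a : ℝ) (hP : 0 < P) (hP' : P ≤ 1000)
    (ha1 : (-1 + Real.sqrt (1 + 4*P)) / (2*P) < a) (ha2 : a ≤ 1) :
    (1/2) * logb 2 (1 + 2*P) >
      (if a ≤ 1/P then logb 2 (1 + P / (1 + a*P))
       else min ((1/2) * logb 2 (1 + P + a*P) + (1/2) * logb 2 (2 + 1/a) - 1)
                (logb 2 (1 + a*P + 1/a) - 1)) - 1/2 := by
  obtain ⟨ha, hroot⟩ := one_lt_add_sq_mul_of_root_lt hP ha1
  have haP : 0 < a * P := mul_pos ha hP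
  have hlog := logb_two_two_mul (show 0 < 1 + 2*P by linarith)
  split_ifs with hle
  · rw [le_div_iff₀ hP] at hle
    have hq : P / (1 + a*P) < a * P := by
      rw [div_lt_iff₀ (by linarith)]
      nlinarith
    have hq0 : 0 < P / (1 + a*P) := by positivity
    have haPP : a * P ≤ P := by nlinarith
    have key : logb 2 ((1 + P / (1 + a*P)) ^ 2) < logb 2 (2 * (1 + 2*P)) :=
      logb_lt_logb (by norm_num) (by positivity) (by nlinarith)
    rw [logb_pow, hlog] at key
    push_cast at key
    linarith
  · rw [not_le, div_lt_iff₀ hP] at hle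
    rcases le_total a (1/10) with hsmall | hlarge
    · have hx : a ^ 2 * P ≤ 10 := by nlinarith
      have key : logb 2 ((1 + a*P + 1/a) ^ 2) < logb 2 (4 * (2 * (1 + 2*P))) := by
        refine logb_lt_logb (by norm_num) (by positivity) ?_
        have e : 1 + a*P + 1/a = (1 + a + a ^ 2 * P) / a := by
          field_simp
          ring
        rw [e, div_pow, div_lt_iff₀ (by positivity)]
        nlinarith [mul_nonneg (sub_nonneg.2 hx)
          (show 0 ≤ a ^ 2 * P - 9/10 by linarith)]
      rw [logb_pow, logb_mul (by norm_num) (by positivity), hlog, logb_two_four] at key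
      push_cast at key
      have := min_le_right ((1/2) * logb 2 (1 + P + a*P) + (1/2) * logb 2 (2 + 1/a) - 1)
        (logb 2 (1 + a*P + 1/a) - 1)
      linarith
    · have key : logb 2 ((1 + P + a*P) * (2 + 1/a)) < logb 2 (4 * (2 * (1 + 2*P))) := by
        refine logb_lt_logb (by norm_num) (by positivity) ?_
        have e : (1 + P + a*P) * (2 + 1/a) = (1 + P + a*P) * (2*a + 1) / a := by
          field_simp
        rw [e, div_lt_iff₀ ha]
        have hc : 0 < 13*a - 1 - 2*a ^ 2 := by nlinarith
        have hPc : 0 < (a*P - 1) * (13*a - 1 - 2*a ^ 2) := mul_pos (by linarith) hc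
        have : 0 < a * (P * (13*a - 1 - 2*a ^ 2) - 1 + 6*a) := by nlinarith
        nlinarith [pos_of_mul_pos_right this ha.le]
      rw [logb_mul (by positivity) (by positivity),
        logb_mul (by norm_num) (by positivity), hlog, logb_two_four] at key
      have := min_le_left ((1/2) * logb 2 (1 + P + a*P) + (1/2) * logb 2 (2 + 1/a) - 1)
        (logb 2 (1 + a*P + 1/a) - 1)
      linarith
end

section
/- Let a > 0 and q > 0 be real numbers with a·(1+a·q) ≤ 1. Then the function g(p) = (1 + p/(1+a·q))·(1 + q/(1+a·p)) is strictly increasing on the set of p > 0 satisfying a·(1+a·p) ≤ 1. Consequently, for 0 < a ≤ 1 and real powers 0 < P₂' ≤ P with a·(1+aP) ≤ 1 and a·(1+aP₂') ≤ 1, one has (1 + P/(1+aP))·(1 + P/(1+aP)) ≥ (1 + P/(1+aP₂'))·(1 + P₂'/(1+aP)). -/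
/-- The exponential of the sum rate of treating interference as noise is strictly increasing in one
power as soon as the noisy interference condition holds for the other one. -/
theorem strictMonoOn_noisy_sumRate {a q : ℝ} (ha : 0 < a) (hq : 0 < q)
    (hnoisy : a * (1 + a*q) ≤ 1) :
    StrictMonoOn (fun p : ℝ => (1 + p / (1 + a*q)) * (1 + q / (1 + a*p))) (Set.Ioi 0) := by
  intro x hx y hy hxy
  rw [Set.mem_Ioi] at hx hy
  have hB : 0 < 1 + a*q := by positivity
  have hX : 0 < 1 + a*x := by positivity
  have hY : 0 < 1 + a*y := by positivity
  rw [← sub_pos]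
  have key : (1 + y / (1 + a*q)) * (1 + q / (1 + a*y))
        - (1 + x / (1 + a*q)) * (1 + q / (1 + a*x))
      = (y - x) * ((1 + a*x) * (1 + a*y) + q * (1 - a * (1 + a*q)))
        / ((1 + a*q) * (1 + a*x) * (1 + a*y)) := by
    field_simp
    ring
  have hsub : 0 < y - x := sub_pos.mpr hxy
  have hslack : 0 ≤ 1 - a * (1 + a*q) := sub_nonneg.mpr hnoisy
  simp only [key]
  positivity

theorem stmt_13 (a q : ℝ) (ha : 0 < a) (hq : 0 < q) (hnoisy : a * (1 + a*q) ≤ 1) :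
    StrictMonoOn (fun p : ℝ => (1 + p / (1 + a*q)) * (1 + q / (1 + a*p)))
      {p : ℝ | 0 < p ∧ a * (1 + a*p) ≤ 1} ∧
    ∀ P P₂' : ℝ, a ≤ 1 → 0 < P₂' → P₂' ≤ P →
      a * (1 + a*P) ≤ 1 → a * (1 + a*P₂') ≤ 1 →
      (1 + P / (1 + a*P)) * (1 + P / (1 + a*P))
        ≥ (1 + P / (1 + a*P₂')) * (1 + P₂' / (1 + a*P)) := by
  refine ⟨(strictMonoOn_noisy_sumRate ha hq hnoisy).mono fun p hp => hp.1, ?_⟩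
  intro P P₂' _ hP₂' hle hP _
  have hPpos : 0 < P := hP₂'.trans_le hle
  have hmono := (strictMonoOn_noisy_sumRate ha hPpos hP).monotoneOn hP₂' hPpos hle
  rw [ge_iff_le, mul_comm (1 + P / (1 + a*P₂'))]
  exact hmono
end

section
/- Let P > 0 and a > 0 be real numbers and let K ≥ 2 be an integer. For each integer s with 0 ≤ s ≤ K−1 set N_s = 1 + (K−1−s)·a·P and h(s) = min{ log2(1 + P/N_s), (1/(s+1))·log2(1 + (P + s·a·P)/N_s) }. Then the maximum of h(s) over 0 ≤ s ≤ K−1 equals max{ h(0), h(K−1) } = max{ log2(1 + P/(1+(K−1)aP)), min{ log2(1+P), (1/K)·log2(1 + P + (K−1)aP) } }. -/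
open Real

/-- The concavity bound `u log (1 + x) ≤ log (1 + u x)` for a weight `u ∈ [0, 1]`. -/
theorem mul_logb_one_add_le {u x : ℝ} (hu : 0 ≤ u) (hu1 : u ≤ 1) (hx : 0 ≤ x) :
    u * logb 2 (1 + x) ≤ logb 2 (1 + u * x) := by
  have hc := strictConcaveOn_log_Ioi.concaveOn.2 (x := 1 + x) (y := 1)
    (Set.mem_Ioi.mpr (by linarith)) (Set.mem_Ioi.mpr one_pos) hu (sub_nonneg.mpr hu1)
    (by ring)
  simp only [smul_eq_mul, log_one, mul_zero, add_zero] at hc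
  have he : u * (1 + x) + (1 - u) * 1 = 1 + u * x := by ring
  rw [he] at hc
  rw [logb, logb, ← mul_div_assoc]
  exact div_le_div_of_nonneg_right hc (log_pos one_lt_two).le

/-- The slope towards `(-1, 0)` of a function on `[0, m]` lying below its chord is at most
the larger of the slopes at the endpoints. -/
theorem div_add_one_le_max_of_le_chord {m s g g₀ g₁ : ℝ} (hm : 0 < m) (hs : 0 ≤ s)
    (hsm : s ≤ m) (hg : g ≤ (1 - s / m) * g₀ + s / m * g₁) :
    g / (s + 1) ≤ max g₀ (g₁ / (m + 1)) := by
  set M := max g₀ (g₁ / (m + 1))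
  have h₀ : g₀ ≤ M := le_max_left _ _
  have h₁ : g₁ ≤ M * (m + 1) := (div_le_iff₀ (by linarith)).mp (le_max_right _ _)
  have ht : 0 ≤ s / m := by positivity
  have ht' : 0 ≤ 1 - s / m := sub_nonneg.mpr ((div_le_one hm).mpr hsm)
  rw [div_le_iff₀ (by linarith)]
  calc g ≤ (1 - s / m) * g₀ + s / m * g₁ := hg
    _ ≤ (1 - s / m) * M + s / m * (M * (m + 1)) := by gcongr
    _ = M * (s + 1) := by field_simp; ring

theorem stmt_15 (P a : ℝ) (hP : 0 < P) (ha : 0 < a) (K : ℕ) (hK : 2 ≤ K) :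
    let N : ℕ → ℝ := fun s => 1 + ((K:ℝ) - 1 - (s:ℝ)) * a * P
    let h : ℕ → ℝ := fun s => min (logb 2 (1 + P / N s))
      ((1/((s:ℝ)+1)) * logb 2 (1 + (P + (s:ℝ)*a*P) / N s))
    (Finset.range K).sup' (Finset.nonempty_range_iff.mpr (by omega)) h
        = max (h 0) (h (K-1)) ∧
      max (h 0) (h (K-1))
        = max (logb 2 (1 + P / (1 + ((K:ℝ)-1)*a*P)))
            (min (logb 2 (1 + P)) ((1/(K:ℝ)) * logb 2 (1 + P + ((K:ℝ)-1)*a*P))) := by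
  intro N h
  have hK' : (2:ℝ) ≤ K := by exact_mod_cast hK
  have hcast : ((K - 1 : ℕ) : ℝ) = (K:ℝ) - 1 := by
    rw [Nat.cast_sub (by omega), Nat.cast_one]
  have hb : 0 < a * P := mul_pos ha hP
  have h_zero : h 0 = logb 2 (1 + P / (1 + ((K:ℝ)-1)*a*P)) := by simp [h, N]
  have h_last : h (K-1) =
      min (logb 2 (1 + P)) ((1/(K:ℝ)) * logb 2 (1 + P + ((K:ℝ)-1)*a*P)) := by
    simp [h, N, hcast, add_assoc]
  refine ⟨le_antisymm (Finset.sup'_le _ _ fun s hs => ?_) (max_le ?_ ?_), by rw [h_zero, h_last]⟩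
  · have hsK : (s:ℝ) ≤ (K:ℝ) - 1 := by
      have : s + 1 ≤ K := Finset.mem_range.mp hs
      have : (s:ℝ) + 1 ≤ K := by exact_mod_cast this
      linarith
    have hs0 : (0:ℝ) ≤ s := s.cast_nonneg
    have hN : 1 ≤ N s := by
      have : 0 ≤ ((K:ℝ) - 1 - s) * (a * P) := mul_nonneg (by linarith) hb.le
      simp only [N]; linarith
    have hx : 0 ≤ ((K:ℝ) - 1) * a * P := by
      rw [mul_assoc]; exact mul_nonneg (by linarith) hb.le
    have hm : 0 < (K:ℝ) - 1 := by linarith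
    set T := 1 + P + ((K:ℝ)-1)*a*P with hT
    have hTpos : 0 < T := by linarith
    have hind : logb 2 (1 + P / N s) ≤ logb 2 (1 + P) := by
      have hdiv : P / N s ≤ P := div_le_self hP.le hN
      have : 0 ≤ P / N s := by positivity
      exact logb_le_logb_of_le one_lt_two (by linarith) (by linarith)
    have hsum : logb 2 (1 + (P + (s:ℝ)*a*P) / N s) = logb 2 T - logb 2 (N s) := by
      rw [← logb_div hTpos.ne' (by linarith)]
      congr 1
      rw [eq_div_iff (by linarith), add_mul, div_mul_cancel₀ _ (by linarith)]
      simp only [N, hT]; ring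
    have h0 : h 0 = logb 2 T - logb 2 (1 + ((K:ℝ)-1)*a*P) := by
      rw [h_zero, ← logb_div hTpos.ne' (by linarith)]
      congr 1
      rw [eq_div_iff (by linarith), add_mul, div_mul_cancel₀ _ (by linarith), hT]
      ring
    have hconc := mul_logb_one_add_le (u := 1 - s / ((K:ℝ) - 1))
      (sub_nonneg.mpr ((div_le_one hm).mpr hsK)) (sub_le_self _ (by positivity)) hx
    have hNs : 1 + (1 - s / ((K:ℝ) - 1)) * (((K:ℝ) - 1) * a * P) = N s := by
      simp only [N]; field_simp
    rw [hNs] at hconc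
    have hslope := div_add_one_le_max_of_le_chord (g := logb 2 T - logb 2 (N s))
      (g₀ := h 0) (g₁ := logb 2 T) hm hs0 hsK (by rw [h0]; linarith)
    rw [sub_add_cancel, ← hsum, div_eq_inv_mul, ← one_div, div_eq_inv_mul (logb 2 T),
      ← one_div (K:ℝ)] at hslope
    rcases le_max_iff.mp hslope with hl | hr
    · exact le_max_of_le_left ((min_le_right _ _).trans hl)
    · rw [h_last]
      exact le_max_of_le_right (min_le_min hind hr)
  · exact Finset.le_sup' h (Finset.mem_range.mpr (by omega))
  · exact Finset.le_sup' h (Finset.mem_range.mpr (by omega))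
end

section
/- Let K ≥ 2 be an integer and let P > 0 and a be real numbers with 1/P < a < 1. Set D = K + 1/a, and for each integer k with 1 ≤ k ≤ K define A_k = log2(1 + k·(aP−1)/D) and B_k = log2(1 + ((k−1)·(aP−1) + P − 1/a)/D). Then the supremum of all real r ≥ 0 satisfying k·r ≤ min{A_k, B_k} for every 1 ≤ k ≤ K−1 and K·r ≤ B_K equals min{ (1/(K−1))·A_{K−1}, (1/K)·B_K }. -/
open Real

theorem mul_logb_two_one_add_mul_le {x s t : ℝ} (hx : 0 < x) (hs : 0 < s) (hst : s ≤ t) :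
    s * logb 2 (1 + t * x) ≤ t * logb 2 (1 + s * x) := by
  have hsx : 0 < s * x := mul_pos hs hx
  have bernoulli : 1 + t / s * (s * x) ≤ (1 + s * x) ^ (t / s) :=
    one_add_mul_self_le_rpow_one_add (by linarith) ((one_le_div hs).2 hst)
  have hts : t / s * (s * x) = t * x := by field_simp
  have htx : 0 < t * x := mul_pos (hs.trans_le hst) hx
  rw [hts] at bernoulli
  have hlog := logb_le_logb_of_le one_lt_two (by linarith) bernoulli
  rw [logb_rpow_eq_mul_logb_of_pos (by linarith)] at hlog
  calc s * logb 2 (1 + t * x) ≤ s * (t / s * logb 2 (1 + s * x)) := by gcongr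
    _ = t * logb 2 (1 + s * x) := by field_simp

theorem stmt_16 (K : ℕ) (hK : 2 ≤ K) (P a : ℝ) (hP : 0 < P)
    (ha1 : 1/P < a) (ha2 : a < 1) :
    let D : ℝ := (K:ℝ) + 1/a
    let A : ℕ → ℝ := fun k => logb 2 (1 + (k:ℝ) * (a*P - 1) / D)
    let B : ℕ → ℝ := fun k => logb 2 (1 + (((k:ℝ) - 1) * (a*P - 1) + P - 1/a) / D)
    sSup {r : ℝ | 0 ≤ r ∧
        (∀ k : ℕ, 1 ≤ k → k ≤ K - 1 → (k:ℝ) * r ≤ min (A k) (B k)) ∧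
        (K:ℝ) * r ≤ B K}
      = min ((1/((K:ℝ)-1)) * A (K-1)) ((1/(K:ℝ)) * B K) := by
  intro D A B
  have ha : 0 < a := (one_div_pos.2 hP).trans ha1
  have haP : 0 < a * P - 1 := sub_pos.2 ((div_lt_iff₀ hP).1 ha1)
  have hK2 : (2 : ℝ) ≤ K := by exact_mod_cast hK
  have hD : 0 < D := by positivity
  set x : ℝ := (a * P - 1) / D with hx_def
  have hx : 0 < x := div_pos haP hD
  have hA : ∀ k, A k = logb 2 (1 + (k : ℝ) * x) := fun k => by
    simp only [A, hx_def, mul_div_assoc]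
  have hA0 : ∀ k, 0 ≤ A k := fun k => by
    rw [hA]
    exact logb_nonneg one_lt_two (le_add_of_nonneg_right (by positivity))
  have hAB : ∀ k, A k ≤ B k := fun k => by
    refine logb_le_logb_of_le one_lt_two (by positivity) ?_
    have hPa : a * P - 1 ≤ P - 1 / a := by
      have : P - 1 / a = (a * P - 1) / a := by field_simp
      rw [this]
      exact le_div_self haP.le ha ha2.le
    gcongr
    linarith
  have hcast : ((K - 1 : ℕ) : ℝ) = (K : ℝ) - 1 := by
    rw [Nat.cast_sub (by omega), Nat.cast_one]
  have hK1 : (0 : ℝ) < (K : ℝ) - 1 := by linarith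
  have hK0 : (0 : ℝ) < K := by linarith
  have hset : {r : ℝ | 0 ≤ r ∧
        (∀ k : ℕ, 1 ≤ k → k ≤ K - 1 → (k:ℝ) * r ≤ min (A k) (B k)) ∧
        (K:ℝ) * r ≤ B K}
      = Set.Icc 0 (min ((1/((K:ℝ)-1)) * A (K-1)) ((1/(K:ℝ)) * B K)) := by
    ext r
    simp only [Set.mem_ofPred_eq, Set.mem_Icc, le_min_iff, one_div_mul_eq_div, le_div_iff₀ hK1,
      le_div_iff₀ hK0, mul_comm r]
    refine and_congr_right fun _ => and_congr_left fun _ => ⟨fun h => ?_, fun h k hk hkK => ?_⟩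
    · rw [← hcast]
      exact (h (K - 1) (by omega) le_rfl).1
    · have hk0 : (0 : ℝ) < k := by exact_mod_cast hk
      have hkK' : (k : ℝ) ≤ (K : ℝ) - 1 := by rw [← hcast]; exact_mod_cast hkK
      have hmono := mul_logb_two_one_add_mul_le hx hk0 hkK'
      rw [← hcast, ← hA, ← hA, hcast] at hmono
      have hkA : (k : ℝ) * r ≤ A k := by
        refine le_of_mul_le_mul_left ?_ hK1
        calc ((K : ℝ) - 1) * (k * r) = k * (((K : ℝ) - 1) * r) := by ring
          _ ≤ k * A (K - 1) := by gcongr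
          _ ≤ ((K : ℝ) - 1) * A k := hmono
      exact ⟨hkA, hkA.trans (hAB k)⟩
  rw [hset, csSup_Icc]
  exact le_min (mul_nonneg (by positivity) (hA0 _))
    (mul_nonneg (by positivity) ((hA0 K).trans (hAB K)))
end

section
/- Let K ≥ 2 be an integer and let P > 0 and a be real numbers with a ≥ 1 and a > 1/P. Set D = K + 1/a, and for each integer k with 1 ≤ k ≤ K define A_k = log2(1 + k·(aP−1)/D) and B_k = log2(1 + ((k−1)·(aP−1) + P − 1/a)/D). Then the supremum of all real r ≥ 0 satisfying k·r ≤ min{A_k, B_k} for every 1 ≤ k ≤ K−1 and K·r ≤ B_K equals min{ B_1, (1/K)·B_K }. -/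
open Real

/-- If `k ↦ log₂ (1 + (k - 1) x + y)` dominates the line `k ↦ k m` at `1` and at `n`, then it
dominates it on all of `[1, n]`. -/
theorem mul_le_logb_of_endpoints {x y n k m : ℝ} (hx : 0 ≤ x) (hy : 0 ≤ y) (hn : 1 < n)
    (hk1 : 1 ≤ k) (hkn : k ≤ n) (h1 : m ≤ logb 2 (1 + y))
    (h2 : n * m ≤ logb 2 (1 + ((n - 1) * x + y))) :
    k * m ≤ logb 2 (1 + ((k - 1) * x + y)) := by
  have hl : 0 < Real.log 2 := Real.log_pos one_lt_two
  have hn0 : 0 < n - 1 := sub_pos.2 hn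
  have hs : 0 ≤ (n - k) / (n - 1) := div_nonneg (sub_nonneg.2 hkn) hn0.le
  have ht : 0 ≤ (k - 1) / (n - 1) := div_nonneg (sub_nonneg.2 hk1) hn0.le
  have hu : 0 < 1 + y := by positivity
  have hv : 0 < 1 + ((n - 1) * x + y) := by positivity
  have key := strictConcaveOn_log_Ioi.concaveOn.2 (Set.mem_Ioi.2 hu) (Set.mem_Ioi.2 hv) hs ht
    (by field_simp; ring)
  simp only [smul_eq_mul] at key
  rw [show (n - k) / (n - 1) * (1 + y) + (k - 1) / (n - 1) * (1 + ((n - 1) * x + y))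
    = 1 + ((k - 1) * x + y) by field_simp; ring] at key
  rw [← Real.log_div_log, le_div_iff₀ hl] at h1 h2 ⊢
  calc k * m * Real.log 2
      = (n - k) / (n - 1) * (m * Real.log 2) + (k - 1) / (n - 1) * (n * m * Real.log 2) := by
        field_simp; ring
    _ ≤ _ := by gcongr
    _ ≤ _ := key

theorem stmt_17 (K : ℕ) (hK : 2 ≤ K) (P a : ℝ) (hP : 0 < P)
    (ha1 : 1 ≤ a) (ha2 : 1/P < a) :
    let D : ℝ := (K:ℝ) + 1/a
    let A : ℕ → ℝ := fun k => logb 2 (1 + (k:ℝ) * (a*P - 1) / D)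
    let B : ℕ → ℝ := fun k => logb 2 (1 + (((k:ℝ) - 1) * (a*P - 1) + P - 1/a) / D)
    sSup {r : ℝ | 0 ≤ r ∧
        (∀ k : ℕ, 1 ≤ k → k ≤ K - 1 → (k:ℝ) * r ≤ min (A k) (B k)) ∧
        (K:ℝ) * r ≤ B K}
      = min (B 1) ((1/(K:ℝ)) * B K) := by
  intro D A B
  have ha0 : 0 < a := one_pos.trans_le ha1
  have hK1 : (1:ℝ) < K := by exact_mod_cast hK
  have hK0 : (0:ℝ) < K := one_pos.trans hK1
  have hD : 0 < D := by positivity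
  have haP : 0 < a * P - 1 := sub_pos.2 ((div_lt_iff₀ hP).1 ha2)
  have hx : 0 < (a * P - 1) / D := div_pos haP hD
  have hy : 0 < (a * P - 1) / D / a := div_pos hx ha0
  have hyx : (a * P - 1) / D / a ≤ (a * P - 1) / D := div_le_self hx.le ha1
  have hA (k : ℕ) : A k = logb 2 (1 + k * ((a * P - 1) / D)) := by
    simp only [A, mul_div_assoc]
  have hB (k : ℕ) :
      B k = logb 2 (1 + (((k:ℝ) - 1) * ((a * P - 1) / D) + (a * P - 1) / D / a)) := by
    simp only [B]
    congr 2
    field_simp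
    ring
  have hB1 : B 1 = logb 2 (1 + (a * P - 1) / D / a) := by simp [hB]
  have hBnonneg (k : ℕ) (hk : 1 ≤ k) : 0 ≤ B k := by
    have hk' : (0:ℝ) ≤ (k:ℝ) - 1 := sub_nonneg.2 (by exact_mod_cast hk)
    rw [hB]
    exact logb_nonneg one_lt_two (le_add_of_nonneg_right (by positivity))
  have hBA (k : ℕ) (hk : 1 ≤ k) : B k ≤ A k := by
    have hk' : (0:ℝ) ≤ (k:ℝ) - 1 := sub_nonneg.2 (by exact_mod_cast hk)
    rw [hA, hB]
    exact logb_le_logb_of_le one_lt_two (by positivity) (by linarith)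
  have hm : (K:ℝ) * min (B 1) (1 / (K:ℝ) * B K) ≤ B K := by
    rw [← le_div_iff₀' hK0, ← one_div_mul_eq_div (K:ℝ) (B K)]
    exact min_le_right (B 1) (1 / (K:ℝ) * B K)
  refine IsGreatest.csSup_eq ⟨⟨le_min (hBnonneg 1 le_rfl)
    (mul_nonneg (by positivity) (hBnonneg K (by omega))), fun k hk1 hkK => ?_, hm⟩, ?_⟩
  · have hk : (k:ℝ) * min (B 1) (1 / (K:ℝ) * B K) ≤ B k := by
      rw [hB k]
      exact mul_le_logb_of_endpoints hx.le hy.le hK1 (by exact_mod_cast hk1)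
        (by exact_mod_cast hkK.trans (Nat.sub_le K 1)) ((min_le_left _ _).trans_eq hB1)
        (hm.trans_eq (hB K))
    exact le_min (hk.trans (hBA k hk1)) hk
  · rintro r ⟨-, h, hr⟩
    refine le_min ?_ ?_
    · simpa using (h 1 le_rfl (by omega)).trans (min_le_right _ _)
    · rwa [one_div, ← div_eq_inv_mul, le_div_iff₀' hK0]
end

section
/- Let P and a be real numbers with (−24+9√10)/26 < P < 142389/2048 and 1/P < a < 1. Then min{ (1/2)·log2( (2/3)·(aP−1)·(1 + 1/(3a)) ), (1/3)·log2( (P − 1/a)·(1 + 1/(3a))² ) } < (1/3)·log2(3P). -/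
open Real

/-- The common-message bound lies below the TDMA rate for interference ratios up to `0.4382`. -/
lemma common_rate_cube_lt {P a : ℝ} (hP : 0 < P) (hP2 : P < 142389 / 2048) (ha : 0 < a)
    (haP : 1 < a * P) (ha2 : a ≤ 0.4382) :
    ((2/3) * (a*P - 1) * (1 + 1/(3*a))) ^ 3 < (3*P) ^ 2 := by
  set X := (2/3) * (a*P - 1) * (1 + 1/(3*a)) with hX
  have hX0 : 0 < X := by
    have : 0 < a * P - 1 := by linarith
    positivity
  have hXa : X = (2/9) * (3*(a*P) + P - 3 - 1/a) := by
    rw [hX]; field_simp; ring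
  have hinv : 2.282 ≤ 1/a := by
    rw [le_div_iff₀ ha]; linarith
  have haP2 : a * P ≤ 0.4382 * P := by gcongr
  have hXk : X ≤ 0.4976 * P := by linarith
  have hXmax : X ≤ 34.6 := by linarith
  calc X ^ 3 = X ^ 2 * X := by ring
    _ ≤ (0.4976 * P) ^ 2 * 34.6 := by gcongr
    _ < (3*P) ^ 2 := by nlinarith [pow_pos hP 2]

/-- The mixed bound lies below the TDMA rate for interference ratios from `0.4382` on. -/
lemma mixed_rate_lt {P a : ℝ} (hP : 0 < P) (hP2 : P < 142389 / 2048) (ha : 0.4382 ≤ a) :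
    (P - 1/a) * (1 + 1/(3*a))^2 < 3*P := by
  have ha0 : 0 < a := by linarith
  have hquad : 1 + 6*a - 18*a^2 ≤ 0.1729 := by nlinarith
  have key : P * (a * (1 + 6*a - 18*a^2)) < (3*a+1)^2 := by
    have hlin : P * (a * (1 + 6*a - 18*a^2)) ≤ 142389 / 2048 * (a * 0.1729) :=
      calc P * (a * (1 + 6*a - 18*a^2)) ≤ P * (a * 0.1729) := by gcongr
        _ ≤ 142389 / 2048 * (a * 0.1729) := by gcongr
    nlinarith
  have heq : (P - 1/a) * (1 + 1/(3*a))^2 = (a*P - 1) * (3*a+1)^2 / (9*a^3) := by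
    field_simp
    ring
  rw [heq, div_lt_iff₀ (by positivity)]
  nlinarith

theorem stmt_18 (P a : ℝ)
    (hP1 : (-24 + 9 * Real.sqrt 10) / 26 < P) (hP2 : P < 142389 / 2048)
    (ha1 : 1/P < a) (ha2 : a < 1) :
    min ((1/2) * logb 2 ((2/3) * (a*P - 1) * (1 + 1/(3*a))))
        ((1/3) * logb 2 ((P - 1/a) * (1 + 1/(3*a))^2))
      < (1/3) * logb 2 (3*P) := by
  have hP : 0 < P := by
    have : (24 : ℝ) / 9 < Real.sqrt 10 := Real.lt_sqrt_of_sq_lt (by norm_num)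
    linarith
  have ha : 0 < a := (one_div_pos.mpr hP).trans ha1
  have haP : 1 < a * P := (div_lt_iff₀ hP).mp ha1
  rcases le_total a 0.4382 with h | h
  · refine min_lt_of_left_lt ?_
    have hpos : 0 < (2/3) * (a*P - 1) * (1 + 1/(3*a)) := by
      have : 0 < a * P - 1 := by linarith
      positivity
    have hlog := Real.logb_lt_logb one_lt_two (by positivity)
      (common_rate_cube_lt hP hP2 ha haP h)
    rw [Real.logb_pow, Real.logb_pow] at hlog
    push_cast at hlog
    linarith
  · refine min_lt_of_right_lt ?_
    have hpos : 0 < P - 1/a := by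
      rw [sub_pos, div_lt_iff₀ ha]; linarith
    have hlog := Real.logb_lt_logb one_lt_two (by positivity) (mixed_rate_lt hP hP2 h)
    linarith
end

section
/- Let P be a real number with (−24+9√10)/26 < P < 441/4. Then for every real a > 4/9, 18·P·a³ − (6P−9)·a² − (P−6)·a + 1 > 0. -/
theorem stmt_19 (P : ℝ) (hP1 : (-24 + 9 * Real.sqrt 10) / 26 < P)
    (hP2 : P < 441 / 4) :
    ∀ a : ℝ, 4/9 < a → 18 * P * a^3 - (6*P - 9) * a^2 - (P - 6) * a + 1 > 0 := by
  intro a ha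
  have hsqrt : (3 : ℝ) < Real.sqrt 10 := Real.lt_sqrt_of_sq_lt (by norm_num)
  have hP : 0 < P := by linarith
  obtain ⟨b, rfl⟩ : ∃ b, a = 4 / 9 + b := ⟨a - 4 / 9, by ring⟩
  have hb : 0 < b := by linarith
  have taylor : 18 * P * (4 / 9 + b)^3 - (6*P - 9) * (4 / 9 + b)^2 - (P - 6) * (4 / 9 + b) + 1
      = (441 - 4 * P) / 81 + ((13 / 3 * P + 14) * b + (18 * P + 9) * b^2 + 18 * P * b^3) := by
    ring
  rw [taylor]
  exact add_pos (by linarith) (by positivity)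
end
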